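/- arXiv:2407.08293 — 3 statements merged into one kernel-verified Lean document; each statement's English description precedes it below -/
import Mathlib

section
/- Suppose k ≥ 2 and q_t < ∞ for all 2 ≤ t ≤ k. (i) If α ∈ G_k satisfies α ≥ q_kβ_k, then there exists a unique permissible vector L ∈ ℤ^k with α = Σ_{t=1}^k l_tβ_t, and moreover every coordinate of L is nonnegative (so L ∈ ℕ₀^k). (ii) In particular, there exists a unique permissible vector L(k) ∈ ℤ^{k−1} with q_kβ_k = Σ_{t=1}^{k−1} L(k)_tβ_t, and all its coordinates are nonnegative. -/
/-! Core combinatorial definitions for the jumping-polynomial construction. -/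

namespace Jump

/-- Tuples of nonnegative integers, indexed by positive integers (index 0 unused). -/
abbrev Vec := ℕ → ℕ

/-- Pairs of tuples. -/
abbrev PVec := Vec × Vec

/-- `A` is a tuple in `ℕ₀^k` (entries indexed by `1, …, k`). -/
def Supp (k : ℕ) (A : Vec) : Prop := ∀ j : ℕ, (j = 0 ∨ k < j) → A j = 0

/-- `A` is a tuple in `ℤ^k` (entries indexed by `1, …, k`). -/
def SuppZ (k : ℕ) (A : ℕ → ℤ) : Prop := ∀ j : ℕ, (j = 0 ∨ k < j) → A j = 0

/-- `(A, C)` is irreducible with respect to a set `T` of pairs of tuples: no member of `T`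
is componentwise less than or equal to `(A, C)`. -/
def Irr (T : Set PVec) (p : PVec) : Prop := ∀ bd ∈ T, ¬ (bd.1 ≤ p.1 ∧ bd.2 ≤ p.2)

/-- The weight `A·β(k) = a₁β₁ + ⋯ + a_kβ_k` of a tuple of nonnegative integers. -/
noncomputable def wtA (β : ℕ → ℝ) (k : ℕ) (A : Vec) : ℝ :=
  ∑ j ∈ Finset.Icc 1 k, (A j : ℝ) * β j

/-- The weight of a tuple of integers. -/
noncomputable def wtZ (β : ℕ → ℝ) (k : ℕ) (A : ℕ → ℤ) : ℝ :=
  ∑ j ∈ Finset.Icc 1 k, (A j : ℝ) * β j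

/-- The weight `|(A, C)| = A·β(k) + C·γ(i)` of a pair of tuples. -/
noncomputable def wt (β γ : ℕ → ℝ) (k i : ℕ) (p : PVec) : ℝ :=
  wtA β k p.1 + wtA γ i p.2

/-- The group `G_n = β₁ℤ + ⋯ + β_nℤ` (as a subset of `ℝ`; `G_0 = {0}`). -/
noncomputable def Gr (β : ℕ → ℝ) (n : ℕ) : Set ℝ :=
  {t | ∃ A : ℕ → ℤ, SuppZ n A ∧ t = wtZ β n A}

/-- The semigroup `S_n = β₁ℕ₀ + ⋯ + β_nℕ₀` (as a subset of `ℝ`; `S_0 = {0}`). -/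
noncomputable def Sg (β : ℕ → ℝ) (n : ℕ) : Set ℝ :=
  {t | ∃ A : Vec, Supp n A ∧ t = wtA β n A}

/-- The set `G_k + H_i`. -/
noncomputable def GrH (β γ : ℕ → ℝ) (k i : ℕ) : Set ℝ :=
  {t | ∃ a ∈ Gr β k, ∃ b ∈ Gr γ i, t = a + b}

/-- The set `G + H_i`, where `G = ⋃_{n ≤ len} G_n`. -/
noncomputable def GH (β γ : ℕ → ℝ) (len : ℕ∞) (i : ℕ) : Set ℝ :=
  {t | ∃ k : ℕ, (k : ℕ∞) ≤ len ∧ t ∈ GrH β γ k i}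

/-- The set `S_k + U_i`. -/
noncomputable def SU (β γ : ℕ → ℝ) (k i : ℕ) : Set ℝ :=
  {t | ∃ a ∈ Sg β k, ∃ b ∈ Sg γ i, t = a + b}

/-- The `j`-th standard basis vector `E_j`. -/
def unitVec (j : ℕ) : Vec := fun l => if l = j then 1 else 0

/-- The set `𝒫 = {(q_jE_j, 0̄) : j ≥ 2, q_j < ∞}`. -/
def Pset (q : ℕ → ℕ∞) : Set PVec :=
  {p | ∃ j : ℕ, 2 ≤ j ∧ ∃ t : ℕ, q j = (t : ℕ∞) ∧
        p = (fun l => t * unitVec j l, fun _ => 0)}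

/-- `(A, C) ∈ ℕ₀^{m_i} × ℕ₀^i` pushes `γ_i`: `c_i > 0` and `|(A, C)| ∈ S_{m_i} + U_{i-1}`. -/
noncomputable def Push (β γ : ℕ → ℝ) (mi i : ℕ) (p : PVec) : Prop :=
  0 < p.2 i ∧ wt β γ mi i p ∈ SU β γ mi (i - 1)

/-- `(A, C)` is reduced: it pushes `γ_i` and no pair strictly below it (componentwise) does. -/
noncomputable def Red (β γ : ℕ → ℝ) (mi i : ℕ) (p : PVec) : Prop :=
  Push β γ mi i p ∧
    ∀ p' : PVec, p'.1 ≤ p.1 → p'.2 ≤ p.2 → p' ≠ p → ¬ Push β γ mi i p'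

/-- The set `𝒟_i`, built from `𝒯_i`: empty if `s_i = ∞`, otherwise the pairs in
`ℕ₀^{m_i} × ℕ₀^i` that are irreducible with respect to `𝒯_i` and reduced. -/
noncomputable def Dstep (β γ : ℕ → ℝ) (s : ℕ → ℕ∞) (m : ℕ → ℕ) (i : ℕ)
    (Ti : Set PVec) : Set PVec :=
  if s i = ⊤ then ∅ else
    {p | Supp (m i) p.1 ∧ Supp i p.2 ∧ Irr Ti p ∧ Red β γ (m i) i p}

/-- The chain `𝒯_1 = 𝒫`, `𝒯_{i+1} = 𝒯_i ∪ 𝒟_i` (here `Tchain 0 = Tchain 1 = 𝒫`,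
which is forced by the convention `s 0 = ⊤`). -/
noncomputable def Tchain (β γ : ℕ → ℝ) (q s : ℕ → ℕ∞) (m : ℕ → ℕ) : ℕ → Set PVec
  | 0 => Pset q
  | n + 1 => Tchain β γ q s m n ∪ Dstep β γ s m n (Tchain β γ q s m n)

/-- The set `𝒯 = ⋃_i 𝒯_i`. -/
noncomputable def Tfull (β γ : ℕ → ℝ) (q s : ℕ → ℕ∞) (m : ℕ → ℕ) : Set PVec :=
  ⋃ n, Tchain β γ q s m n

/-- A tuple `A ∈ ℤ^k` is permissible: `0 ≤ a_j < q_j` for all `1 ≤ j ≤ k` with `q_j < ∞`. -/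
def PermZ (q : ℕ → ℕ∞) (k : ℕ) (A : ℕ → ℤ) : Prop :=
  ∀ j : ℕ, 1 ≤ j → j ≤ k → ∀ t : ℕ, q j = (t : ℕ∞) → 0 ≤ A j ∧ A j < (t : ℤ)

/-- A tuple `A ∈ ℕ₀^k` is permissible: `a_j < q_j` for all `1 ≤ j ≤ k` with `q_j < ∞`. -/
def PermN (q : ℕ → ℕ∞) (k : ℕ) (A : Vec) : Prop :=
  ∀ j : ℕ, 1 ≤ j → j ≤ k → ∀ t : ℕ, q j = (t : ℕ∞) → A j < t

/-- The abstract combinatorial setup of the jumping-polynomial construction: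
a finite (of length `len`) or infinite (`len = ⊤`) sequence `β` of positive reals,
a sequence `γ` of nonnegative reals, and the derived data `q_j`, `s_i`, `m_i`
defined by their minimality properties. -/
structure Setup where
  /-- the length of the `β`-sequence (possibly `∞`) -/
  len : ℕ∞
  β : ℕ → ℝ
  γ : ℕ → ℝ
  q : ℕ → ℕ∞
  s : ℕ → ℕ∞
  m : ℕ → ℕ
  hlen : 2 ≤ len
  hβ : ∀ j : ℕ, 1 ≤ j → (j : ℕ∞) ≤ len → 0 < β j
  hγ : ∀ i : ℕ, 1 ≤ i → 0 ≤ γ i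
  hq1 : q 1 = ⊤
  hqtop : ∀ j : ℕ, len < (j : ℕ∞) → q j = ⊤
  hq : ∀ j : ℕ, 2 ≤ j → (j : ℕ∞) ≤ len →
    q j = sInf {x : ℕ∞ | ∃ t : ℕ, x = (t : ℕ∞) ∧ 0 < t ∧ (t : ℝ) * β j ∈ Gr β (j - 1)}
  /-- if `q_j = ∞` then `β_j` is the last term of the `β`-sequence, and conversely -/
  hlast : ∀ j : ℕ, 2 ≤ j → (j : ℕ∞) ≤ len → (q j = ⊤ ↔ len = (j : ℕ∞))
  /-- `β_{j+1} > q_jβ_j` whenever `q_j < ∞` -/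
  hgrow : ∀ j : ℕ, 2 ≤ j → (j : ℕ∞) ≤ len → ∀ t : ℕ, q j = (t : ℕ∞) →
    (t : ℝ) * β j < β (j + 1)
  hs0 : s 0 = ⊤
  hs : ∀ i : ℕ, 1 ≤ i →
    s i = sInf {x : ℕ∞ | ∃ t : ℕ, x = (t : ℕ∞) ∧ 0 < t ∧ (t : ℝ) * γ i ∈ GH β γ len (i - 1)}
  hm0 : m 0 = 1
  hmtop : ∀ i : ℕ, 1 ≤ i → s i = ⊤ → m i = m (i - 1)
  hmfin : ∀ i : ℕ, 1 ≤ i → ∀ t : ℕ, s i = (t : ℕ∞) →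
    m i = max (m (i - 1))
      (sInf {j : ℕ | 1 ≤ j ∧ (j : ℕ∞) ≤ len ∧ (t : ℝ) * γ i ∈ GrH β γ j (i - 1)})
  hmlen : ∀ i : ℕ, 1 ≤ m i ∧ ((m i : ℕ) : ℕ∞) ≤ len

end Jump

namespace Jump

lemma wtZ_succ (β : ℕ → ℝ) (n : ℕ) (A : ℕ → ℤ) :
    wtZ β (n + 1) A = wtZ β n A + (A (n + 1) : ℝ) * β (n + 1) := by
  unfold wtZ
  exact Finset.sum_Icc_succ_top (by omega) _

lemma wtZ_one (β : ℕ → ℝ) (A : ℕ → ℤ) : wtZ β 1 A = (A 1 : ℝ) * β 1 := by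
  simp [wtZ]

lemma wtZ_congr {β : ℕ → ℝ} {n : ℕ} {A B : ℕ → ℤ}
    (h : ∀ j, 1 ≤ j → j ≤ n → A j = B j) : wtZ β n A = wtZ β n B := by
  refine Finset.sum_congr rfl fun j hj => ?_
  rw [Finset.mem_Icc] at hj
  rw [h j hj.1 hj.2]

lemma wtZ_mem_Gr (β : ℕ → ℝ) (n : ℕ) (A : ℕ → ℤ) : wtZ β n A ∈ Gr β n := by
  refine ⟨fun j => if j = 0 ∨ n < j then 0 else A j, fun j hj => by simp [hj], ?_⟩
  refine wtZ_congr fun j h1 h2 => ?_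
  rw [if_neg (by omega)]

lemma Gr_add_zsmul {β : ℕ → ℝ} {n : ℕ} {x y : ℝ} (hx : x ∈ Gr β n) (hy : y ∈ Gr β n) (c : ℤ) :
    x + c * y ∈ Gr β n := by
  obtain ⟨A, -, rfl⟩ := hx
  obtain ⟨B, -, rfl⟩ := hy
  convert wtZ_mem_Gr β n (fun j => A j + c * B j) using 1
  simp only [wtZ, Finset.mul_sum, ← Finset.sum_add_distrib]
  refine Finset.sum_congr rfl fun j _ => ?_
  push_cast
  ring

namespace Setup

lemma q_spec (d : Setup) {j t : ℕ} (h2 : 2 ≤ j) (hj : (j : ℕ∞) ≤ d.len) (ht : d.q j = (t : ℕ∞)) :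
    0 < t ∧ (t : ℝ) * d.β j ∈ Gr d.β (j - 1) ∧
      ∀ u : ℕ, 0 < u → (u : ℝ) * d.β j ∈ Gr d.β (j - 1) → t ≤ u := by
  have hq := d.hq j h2 hj
  rw [ht] at hq
  set S := {x : ℕ∞ | ∃ t : ℕ, x = (t : ℕ∞) ∧ 0 < t ∧ (t : ℝ) * d.β j ∈ Gr d.β (j - 1)}
  have hne : S.Nonempty := by
    by_contra h
    rw [Set.not_nonempty_iff_eq_empty.mp h, sInf_empty] at hq
    exact ENat.natCast_ne_top t hq
  obtain ⟨u, hu, hu0, hmem⟩ := hq ▸ csInf_mem hne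
  obtain rfl : t = u := by exact_mod_cast hu
  refine ⟨hu0, hmem, fun u hu0 hu => ?_⟩
  have : (t : ℕ∞) ≤ u := hq ▸ sInf_le (⟨u, rfl, hu0, hu⟩ : (u : ℕ∞) ∈ S)
  exact_mod_cast this

/-- Existence of permissible representations, up to entries outside `1, …, n`. -/
lemma exists_permZ (d : Setup) {n : ℕ} (hn : 1 ≤ n) (hl : (n : ℕ∞) ≤ d.len)
    (hfin : ∀ t : ℕ, 2 ≤ t → t ≤ n → d.q t ≠ ⊤) {α : ℝ} (hα : α ∈ Gr d.β n) :
    ∃ L : ℕ → ℤ, PermZ d.q n L ∧ α = wtZ d.β n L := by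
  induction n, hn using Nat.le_induction generalizing α with
  | base =>
    obtain ⟨A, -, hA⟩ := hα
    refine ⟨A, fun j h1 h2 t ht => ?_, hA⟩
    obtain rfl : j = 1 := by omega
    simp [d.hq1] at ht
  | succ n hn ih =>
    obtain ⟨A, -, rfl⟩ := hα
    obtain ⟨Q, hQ⟩ := ENat.ne_top_iff_exists.mp (hfin (n + 1) (by omega) le_rfl)
    obtain ⟨hQ0, hQG, -⟩ := d.q_spec (by omega) hl hQ.symm
    rw [Nat.add_sub_cancel] at hQG
    have hQ0' : (0 : ℤ) < Q := by exact_mod_cast hQ0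
    obtain ⟨L, hL, hLw⟩ := ih (le_trans (by exact_mod_cast n.le_succ) hl)
      (fun t h2 h => hfin t h2 (by omega))
      (Gr_add_zsmul (wtZ_mem_Gr d.β n A) hQG (A (n + 1) / Q))
    refine ⟨Function.update L (n + 1) (A (n + 1) % Q), fun j h1 h2 t ht => ?_, ?_⟩
    · rcases Nat.lt_or_ge n j with h | h
      · obtain rfl : j = n + 1 := by omega
        obtain rfl : Q = t := by exact_mod_cast hQ.trans ht
        rw [Function.update_self]
        exact ⟨Int.emod_nonneg _ hQ0'.ne', Int.emod_lt_of_pos _ hQ0'⟩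
      · rw [Function.update_of_ne (by omega)]
        exact hL j h1 h t ht
    · have hcongr : wtZ d.β n (Function.update L (n + 1) (A (n + 1) % Q)) = wtZ d.β n L :=
        wtZ_congr fun j _ _ => Function.update_of_ne (by omega) _ _
      have hdiv : ((A (n + 1) : ℤ) : ℝ) =
          (Q : ℝ) * ((A (n + 1) / Q : ℤ) : ℝ) + ((A (n + 1) % Q : ℤ) : ℝ) := by
        exact_mod_cast (Int.mul_ediv_add_emod (A (n + 1)) Q).symm
      rw [wtZ_succ, wtZ_succ, Function.update_self, hcongr, ← hLw, hdiv]
      ring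

/-- If a multiple of `β_j` by an integer of absolute value below `q_j` lies in `G_{j-1}`, then
the multiplier is zero. -/
lemma eq_zero_of_mul_mem_Gr (d : Setup) {j t : ℕ} (h2 : 2 ≤ j) (hj : (j : ℕ∞) ≤ d.len)
    (ht : d.q j = (t : ℕ∞)) {c : ℤ} (hc : |c| < t) (hmem : (c : ℝ) * d.β j ∈ Gr d.β (j - 1)) :
    c = 0 := by
  by_contra hc0
  have hzero : (0 : ℝ) ∈ Gr d.β (j - 1) := by
    convert wtZ_mem_Gr d.β (j - 1) 0 using 1
    simp [wtZ]
  have habs : (c.natAbs : ℝ) * d.β j ∈ Gr d.β (j - 1) := by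
    convert Gr_add_zsmul hzero hmem c.sign using 1
    have : ((c.natAbs : ℤ) : ℝ) = (c.sign : ℝ) * c := by
      rw [← Int.sign_mul_self_eq_natAbs]
      push_cast
      rfl
    rw [← Int.cast_natCast, this]
    ring
  have := (d.q_spec h2 hj ht).2.2 c.natAbs (Int.natAbs_pos.mpr hc0) habs
  rw [Int.abs_eq_natAbs] at hc
  omega

lemma permZ_unique (d : Setup) {n : ℕ} (hn : 1 ≤ n) (hl : (n : ℕ∞) ≤ d.len)
    (hfin : ∀ t : ℕ, 2 ≤ t → t ≤ n → d.q t ≠ ⊤) {L M : ℕ → ℤ} (hL : PermZ d.q n L)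
    (hM : PermZ d.q n M) (h : wtZ d.β n L = wtZ d.β n M) :
    ∀ j, 1 ≤ j → j ≤ n → L j = M j := by
  induction n, hn using Nat.le_induction with
  | base =>
    intro j h1 h2
    obtain rfl : j = 1 := by omega
    rw [wtZ_one, wtZ_one] at h
    exact_mod_cast mul_right_cancel₀ (d.hβ 1 le_rfl hl).ne' h
  | succ n hn ih =>
    obtain ⟨Q, hQ⟩ := ENat.ne_top_iff_exists.mp (hfin (n + 1) (by omega) le_rfl)
    obtain ⟨hL0, hL1⟩ := hL (n + 1) (by omega) le_rfl Q hQ.symm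
    obtain ⟨hM0, hM1⟩ := hM (n + 1) (by omega) le_rfl Q hQ.symm
    rw [wtZ_succ, wtZ_succ] at h
    have hmem : ((L (n + 1) - M (n + 1) : ℤ) : ℝ) * d.β (n + 1) ∈ Gr d.β (n + 1 - 1) := by
      rw [Nat.add_sub_cancel]
      convert Gr_add_zsmul (wtZ_mem_Gr d.β n M) (wtZ_mem_Gr d.β n L) (-1) using 1
      push_cast
      linear_combination h
    have htop : L (n + 1) = M (n + 1) := by
      have := d.eq_zero_of_mul_mem_Gr (by omega) hl hQ.symm
        (abs_lt.mpr ⟨by omega, by omega⟩) hmem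
      omega
    have hlow := ih (le_trans (by exact_mod_cast n.le_succ) hl)
      (fun t h2 h => hfin t h2 (by omega)) (fun j h1 h2 => hL j h1 (by omega))
      (fun j h1 h2 => hM j h1 (by omega)) (by rw [htop] at h; linarith)
    intro j h1 h2
    rcases Nat.lt_or_ge n j with hj | hj
    · obtain rfl : j = n + 1 := by omega
      exact htop
    · exact hlow j h1 hj

/-- The entries other than the first of a permissible tuple contribute less than `q_nβ_n`. -/
lemma wtZ_lt (d : Setup) {n : ℕ} (hn : 2 ≤ n) (hl : (n : ℕ∞) ≤ d.len)
    (hfin : ∀ t : ℕ, 2 ≤ t → t ≤ n → d.q t ≠ ⊤) {L : ℕ → ℤ} (hL : PermZ d.q n L)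
    {Q : ℕ} (hQ : d.q n = (Q : ℕ∞)) :
    wtZ d.β n L < (L 1 : ℝ) * d.β 1 + (Q : ℝ) * d.β n := by
  induction n, hn using Nat.le_induction generalizing Q with
  | base =>
    have hlt : (L 2 : ℝ) < Q := by exact_mod_cast (hL 2 (by omega) le_rfl Q hQ).2
    rw [wtZ_succ, wtZ_one]
    have := mul_lt_mul_of_pos_right hlt (d.hβ 2 (by omega) hl)
    linarith
  | succ n hn ih =>
    have hl' : (n : ℕ∞) ≤ d.len := le_trans (by exact_mod_cast n.le_succ) hl
    obtain ⟨R, hR⟩ := ENat.ne_top_iff_exists.mp (hfin n hn (by omega))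
    have hlow := ih hl' (fun t h2 h => hfin t h2 (by omega))
      (fun j h1 h2 => hL j h1 (by omega)) hR.symm
    have hgrow := d.hgrow n hn hl' R hR.symm
    have hle : (L (n + 1) : ℝ) + 1 ≤ Q := by
      exact_mod_cast (hL (n + 1) (by omega) le_rfl Q hQ).2
    have := mul_le_mul_of_nonneg_right hle (d.hβ (n + 1) (by omega) hl).le
    rw [wtZ_succ]
    linarith

lemma nonneg_of_first_pos (d : Setup) {n : ℕ}
    (hfin : ∀ t : ℕ, 2 ≤ t → t ≤ n → d.q t ≠ ⊤) {L : ℕ → ℤ} (hS : SuppZ n L)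
    (hL : PermZ d.q n L) (h1 : 0 < (L 1 : ℝ) * d.β 1) (hβ : 0 < d.β 1) (j : ℕ) : 0 ≤ L j := by
  by_cases hj : j = 0 ∨ n < j
  · exact (hS j hj).ge
  push Not at hj
  obtain rfl | hj2 : j = 1 ∨ 2 ≤ j := by omega
  · exact_mod_cast (pos_of_mul_pos_left h1 hβ.le).le
  · obtain ⟨Q, hQ⟩ := ENat.ne_top_iff_exists.mp (hfin j hj2 hj.2)
    exact (hL j (by omega) hj.2 Q hQ.symm).1

lemma existsUnique_permZ (d : Setup) {n : ℕ} (hn : 1 ≤ n) (hl : (n : ℕ∞) ≤ d.len)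
    (hfin : ∀ t : ℕ, 2 ≤ t → t ≤ n → d.q t ≠ ⊤) {α : ℝ} (hα : α ∈ Gr d.β n) :
    ∃! L : ℕ → ℤ, SuppZ n L ∧ PermZ d.q n L ∧ α = wtZ d.β n L := by
  obtain ⟨L, hL, hw⟩ := d.exists_permZ hn hl hfin hα
  have hagree : ∀ j, 1 ≤ j → j ≤ n → (if j = 0 ∨ n < j then 0 else L j) = L j :=
    fun j h1 h2 => if_neg (by omega)
  refine ⟨fun j => if j = 0 ∨ n < j then 0 else L j,
    ⟨fun j hj => if_pos hj, fun j h1 h2 t ht => ?_, hw.trans (wtZ_congr hagree).symm⟩, ?_⟩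
  · simpa only [hagree j h1 h2] using hL j h1 h2 t ht
  · rintro M ⟨hMS, hM, hMw⟩
    funext j
    by_cases hj : j = 0 ∨ n < j
    · simp only [if_pos hj, hMS j hj]
    · simp only [if_neg hj]
      exact d.permZ_unique hn hl hfin hM hL (hMw.symm.trans hw) j (by omega) (by omega)

end Setup

/-- Corollary: `P` is well defined. Assume `q_t < ∞` for `2 ≤ t ≤ k`.
(i) Every `α ∈ G_k` with `α ≥ q_kβ_k` has a unique permissible representation
`α = L·β(k)`, and that `L` has nonnegative entries.
(ii) In particular `q_kβ_k` has a unique permissible representation `L(k)·β(k-1)`,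
with nonnegative entries. -/
theorem P_well_defined (d : Setup) (k : ℕ) (hk : 2 ≤ k) (hkl : (k : ℕ∞) ≤ d.len)
    (hqfin : ∀ t : ℕ, 2 ≤ t → t ≤ k → d.q t ≠ ⊤)
    (qk : ℕ) (hqk : d.q k = (qk : ℕ∞)) :
    (∀ α : ℝ, α ∈ Gr d.β k → (qk : ℝ) * d.β k ≤ α →
      (∃! L : ℕ → ℤ, SuppZ k L ∧ PermZ d.q k L ∧ α = wtZ d.β k L) ∧
      (∀ L : ℕ → ℤ, SuppZ k L ∧ PermZ d.q k L ∧ α = wtZ d.β k L → ∀ j, 0 ≤ L j)) ∧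
    ((∃! L : ℕ → ℤ, SuppZ (k - 1) L ∧ PermZ d.q (k - 1) L ∧
        (qk : ℝ) * d.β k = wtZ d.β (k - 1) L) ∧
      (∀ L : ℕ → ℤ, SuppZ (k - 1) L ∧ PermZ d.q (k - 1) L ∧
        (qk : ℝ) * d.β k = wtZ d.β (k - 1) L → ∀ j, 0 ≤ L j)) := by
  obtain ⟨n, rfl⟩ : ∃ n, k = n + 1 := ⟨k - 1, by omega⟩
  rw [Nat.add_sub_cancel]
  have hnl : (n : ℕ∞) ≤ d.len := le_trans (by exact_mod_cast n.le_succ) hkl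
  have hnfin : ∀ t : ℕ, 2 ≤ t → t ≤ n → d.q t ≠ ⊤ := fun t h2 h => hqfin t h2 (by omega)
  have hβ1 : 0 < d.β 1 := d.hβ 1 le_rfl (le_trans (by exact_mod_cast (by omega : 1 ≤ n + 1)) hkl)
  have hβk : 0 < d.β (n + 1) := d.hβ (n + 1) (by omega) hkl
  obtain ⟨hq0, hqG, -⟩ := d.q_spec hk hkl hqk
  refine ⟨fun α hα hle => ⟨d.existsUnique_permZ (by omega) hkl hqfin hα, ?_⟩,
    d.existsUnique_permZ (by omega) hnl hnfin hqG, ?_⟩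
  · rintro L ⟨hS, hL, rfl⟩
    have := d.wtZ_lt hk hkl hqfin hL hqk
    exact d.nonneg_of_first_pos hqfin hS hL (by linarith) hβ1
  · rintro L ⟨hS, hL, hw⟩
    refine d.nonneg_of_first_pos hnfin hS hL ?_ hβ1
    have hq1 : (1 : ℝ) ≤ qk := by exact_mod_cast hq0
    have hmul : d.β (n + 1) ≤ qk * d.β (n + 1) := le_mul_of_one_le_left hβk.le hq1
    obtain rfl | hn2 : n = 1 ∨ 2 ≤ n := by omega
    · rw [wtZ_one] at hw
      linarith
    · obtain ⟨R, hR⟩ := ENat.ne_top_iff_exists.mp (hnfin n hn2 le_rfl)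
      have hlt := d.wtZ_lt hn2 hnl hnfin hL hR.symm
      have hgrow := d.hgrow n hn2 hnl R hR.symm
      linarith

end Jump
end

section
/- Suppose k ∈ ℕ and i ∈ ℕ₀ are such that k > m_i. If α ∈ G_k is such that α ∈ G_{k−1} + H_i, then α ∈ G_{k−1}. -/
namespace Jump

/-- The group `G_n` as an additive subgroup of `ℝ`. -/
noncomputable def grSubgroup (β : ℕ → ℝ) (n : ℕ) : AddSubgroup ℝ where
  carrier := Gr β n
  zero_mem' := ⟨0, fun _ _ => rfl, by simp [wtZ]⟩
  add_mem' := by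
    rintro _ _ ⟨A, hA, rfl⟩ ⟨B, hB, rfl⟩
    refine ⟨A + B, fun j hj => by simp [hA j hj, hB j hj], ?_⟩
    simp [wtZ, add_mul, Finset.sum_add_distrib]
  neg_mem' := by
    rintro _ ⟨A, hA, rfl⟩
    exact ⟨-A, fun j hj => by simp [hA j hj], by simp [wtZ]⟩

theorem mem_grSubgroup {β : ℕ → ℝ} {n : ℕ} {x : ℝ} : x ∈ grSubgroup β n ↔ x ∈ Gr β n :=
  Iff.rfl

theorem grSubgroup_mono (β : ℕ → ℝ) : Monotone (grSubgroup β) := by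
  rintro m n hmn _ ⟨A, hA, rfl⟩
  refine ⟨A, fun j hj => hA j (by omega), ?_⟩
  refine Finset.sum_subset (Finset.Icc_subset_Icc_right hmn) fun j hj hj' => ?_
  rw [hA j (by simp only [Finset.mem_Icc] at hj hj'; omega)]
  simp

theorem eq_zero_of_mem_Gr_zero {β : ℕ → ℝ} {x : ℝ} (hx : x ∈ Gr β 0) : x = 0 := by
  obtain ⟨A, -, rfl⟩ := hx
  simp [wtZ]

theorem exists_eq_add_mul_of_mem_Gr_succ {β : ℕ → ℝ} {n : ℕ} {x : ℝ} (hx : x ∈ Gr β (n + 1)) :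
    ∃ b ∈ Gr β n, ∃ c : ℤ, x = b + c * β (n + 1) := by
  obtain ⟨A, hA, rfl⟩ := hx
  refine ⟨_, ⟨fun j => if j ≤ n then A j else 0, fun j hj => ?_, rfl⟩, A (n + 1), ?_⟩
  · rcases hj with rfl | hj
    · simp [hA 0 (Or.inl rfl)]
    · simp [hj.not_ge]
  · rw [wtZ, Finset.sum_Icc_succ_top (by omega), wtZ]
    congr 1
    exact Finset.sum_congr rfl fun j hj => by simp [(Finset.mem_Icc.mp hj).2]

theorem mem_GrH_iff {β γ : ℕ → ℝ} {k i : ℕ} {x : ℝ} :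
    x ∈ GrH β γ k i ↔ x ∈ grSubgroup β k ⊔ grSubgroup γ i := by
  simp only [AddSubgroup.mem_sup, mem_grSubgroup, GrH, Set.mem_ofPred_eq, eq_comm]

theorem Setup.m_le_m_succ (d : Setup) (i : ℕ) : d.m i ≤ d.m (i + 1) := by
  cases h : d.s (i + 1) with
  | top => simpa using (d.hmtop (i + 1) (by omega) h).ge
  | coe t =>
    rw [d.hmfin (i + 1) (by omega) t h]
    exact le_max_left _ _

/-- An integer multiple of `γ_{i+1}` in `G_n + H_i` is already in `G_{m_{i+1}} + H_i`. -/
theorem Setup.mul_mem_GrH_m (d : Setup) {n i : ℕ} (hn : (n : ℕ∞) ≤ d.len) {c : ℤ}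
    (hc : (c : ℝ) * d.γ (i + 1) ∈ GrH d.β d.γ n i) :
    (c : ℝ) * d.γ (i + 1) ∈ GrH d.β d.γ (d.m (i + 1)) i := by
  have mono : ∀ {k l x}, k ≤ l → x ∈ GrH d.β d.γ k i → x ∈ GrH d.β d.γ l i := by
    intro k l x hkl hx
    rw [mem_GrH_iff] at hx ⊢
    exact sup_le_sup_right (grSubgroup_mono d.β hkl) _ hx
  have hs := d.hs (i + 1) (by omega)
  rw [Nat.add_sub_cancel] at hs
  have hle : ∀ t : ℕ, 0 < t → (t : ℝ) * d.γ (i + 1) ∈ GH d.β d.γ d.len i →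
      d.s (i + 1) ≤ t := fun t ht h => hs ▸ sInf_le ⟨t, rfl, ht, h⟩
  rcases eq_or_ne c 0 with rfl | hc0
  · rw [mem_GrH_iff]
    simp
  have habs : (c.natAbs : ℝ) * d.γ (i + 1) ∈ GrH d.β d.γ n i := by
    rcases Int.natAbs_eq c with h | h
    · rwa [h, Int.cast_natCast] at hc
    · rw [h, mem_GrH_iff] at hc
      rw [mem_GrH_iff]
      simpa using neg_mem hc
  have hmem := csInf_mem (s := {x : ℕ∞ | ∃ t : ℕ, x = (t : ℕ∞) ∧ 0 < t ∧
    (t : ℝ) * d.γ (i + 1) ∈ GH d.β d.γ d.len i})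
    ⟨_, c.natAbs, rfl, Int.natAbs_pos.mpr hc0, n, hn, habs⟩
  rw [← hs] at hmem
  obtain ⟨t, hst, ht, l, hl, htl⟩ := hmem
  have hm := d.hmfin (i + 1) (by omega) t hst
  rw [Nat.add_sub_cancel] at hm
  have hj := Nat.sInf_mem (s := {j : ℕ | 1 ≤ j ∧ (j : ℕ∞) ≤ d.len ∧
      (t : ℝ) * d.γ (i + 1) ∈ GrH d.β d.γ j i}) (by
    refine ⟨max 1 l, le_max_left _ _, ?_, mono (le_max_right _ _) htl⟩
    rcases max_choice 1 l with h | h <;> rw [h]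
    · exact le_trans (by norm_num) d.hlen
    · exact hl)
  have htm : (t : ℝ) * d.γ (i + 1) ∈ GrH d.β d.γ (d.m (i + 1)) i :=
    mono (hm ▸ le_max_right _ _) hj.2.2
  have hdvd : (t : ℤ) ∣ c := by
    have hr0 := Int.emod_nonneg c (b := (t : ℤ)) (by omega)
    have hrt := Int.emod_lt_of_pos c (b := (t : ℤ)) (by omega)
    have hdiv := Int.emod_add_mul_ediv c t
    obtain ⟨r, hr⟩ := Int.eq_ofNat_of_zero_le hr0
    rw [hr] at hrt hdiv
    by_contra hnd
    have hrpos : 0 < r := by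
      rcases Nat.eq_zero_or_pos r with rfl | h
      · exact absurd (Int.dvd_of_emod_eq_zero hr) hnd
      · exact h
    have hmax : ((max n (d.m (i + 1)) : ℕ) : ℕ∞) ≤ d.len := by
      rcases max_choice n (d.m (i + 1)) with h | h <;> rw [h]
      · exact hn
      · exact (d.hmlen _).2
    have hrle : d.s (i + 1) ≤ r := hle r hrpos ⟨max n (d.m (i + 1)), hmax, by
      have h1 := mono (le_max_left n (d.m (i + 1))) hc
      have h2 := mono (le_max_right n (d.m (i + 1))) htm
      rw [mem_GrH_iff] at h1 h2 ⊢
      have h3 := sub_mem h1 (zsmul_mem h2 (c / t))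
      have hcast : (r : ℝ) + t * ((c / t : ℤ) : ℝ) = c := by exact_mod_cast hdiv
      convert h3 using 1
      rw [zsmul_eq_mul, ← hcast]
      ring⟩
    rw [hst] at hrle
    have : t ≤ r := by exact_mod_cast hrle
    omega
  obtain ⟨e, rfl⟩ := hdvd
  rw [mem_GrH_iff] at htm ⊢
  have h := zsmul_mem htm e
  rw [zsmul_eq_mul] at h
  convert h using 1
  push_cast
  ring

/-- Lemma: auxiliary. If `k > m_i`, `α ∈ G_k` and
`α ∈ G_{k-1} + H_i`, then `α ∈ G_{k-1}`. -/
theorem aux_group_membership (d : Setup) (k i : ℕ) (hki : d.m i < k)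
    (hkl : (k : ℕ∞) ≤ d.len) (α : ℝ)
    (h1 : α ∈ Gr d.β k) (h2 : α ∈ GrH d.β d.γ (k - 1) i) :
    α ∈ Gr d.β (k - 1) := by
  induction i with
  | zero =>
    obtain ⟨a, ha, b, hb, rfl⟩ := h2
    rwa [eq_zero_of_mem_Gr_zero hb, add_zero]
  | succ i ih =>
    refine ih ((d.m_le_m_succ i).trans_lt hki) ?_
    obtain ⟨a, ha, b, hb, hab⟩ := h2
    obtain ⟨b', hb', c, rfl⟩ := exists_eq_add_mul_of_mem_Gr_succ hb
    have hsub : (a + b' : ℝ) ∈ grSubgroup d.β (k - 1) ⊔ grSubgroup d.γ i :=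
      mem_GrH_iff.mp ⟨a, ha, b', hb', rfl⟩
    have hc : (c : ℝ) * d.γ (i + 1) ∈ GrH d.β d.γ k i := by
      refine ⟨α - a, ?_, -b', (grSubgroup d.γ i).neg_mem hb', by rw [hab]; ring⟩
      exact (grSubgroup d.β k).sub_mem h1 (grSubgroup_mono d.β (Nat.sub_le k 1) ha)
    have hcm := mem_GrH_iff.mp (d.mul_mem_GrH_m hkl hc)
    rw [mem_GrH_iff, hab, ← add_assoc]
    exact add_mem hsub (sup_le_sup_right (grSubgroup_mono d.β (Nat.le_sub_one_of_lt hki)) _ hcm)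

end Jump
end

section
/- The value semigroup ν(R∖{0}) is exactly the set of all ℕ₀-linear combinations of the seven real numbers 1, √2, 2√2 − 1, 5√2 − 4, √51 − 2, √51 + √2 − 3, and 2√51 − 5; moreover this generating set is minimal: none of these seven numbers is an ℕ₀-linear combination of the other six. -/
/-! The example of section 5: the monomial valuation with `ν(x) = 1`, `ν(y) = √2`,
`ν(z′) = √51 − 5` on `𝐤(x, y, z′)`. -/

namespace JumpExample

/-- The rational function field `K = 𝕜(x, y, z′)` in three variables. -/
abbrev Kex (𝕜 : Type) [Field 𝕜] : Type := FractionRing (MvPolynomial (Fin 3) 𝕜)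

/-- The embedding of the polynomial ring into `K`. -/
noncomputable def emb (𝕜 : Type) [Field 𝕜] : MvPolynomial (Fin 3) 𝕜 →+* Kex 𝕜 :=
  algebraMap (MvPolynomial (Fin 3) 𝕜) (Kex 𝕜)

/-- The variables `x`, `y`, `z′` of `K`. -/
noncomputable def xv (𝕜 : Type) [Field 𝕜] : Kex 𝕜 := emb 𝕜 (MvPolynomial.X 0)
noncomputable def yv (𝕜 : Type) [Field 𝕜] : Kex 𝕜 := emb 𝕜 (MvPolynomial.X 1)
noncomputable def z'v (𝕜 : Type) [Field 𝕜] : Kex 𝕜 := emb 𝕜 (MvPolynomial.X 2)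

/-- The weight `a + b√2 + c(√51 − 5)` of a monomial `x^a y^b z′^c`. -/
noncomputable def wdeg (dd : Fin 3 →₀ ℕ) : ℝ :=
  (dd 0 : ℝ) + (dd 1 : ℝ) * Real.sqrt 2 + (dd 2 : ℝ) * (Real.sqrt 51 - 5)

/-- The hypotheses on `ν`: a rank 1 valuation on `K`, trivial on `𝕜`, which is the
monomial valuation with `ν(x) = 1`, `ν(y) = √2`, `ν(z′) = √51 − 5`. -/
structure IsMonomialValuation (𝕜 : Type) [Field 𝕜] (ν : Kex 𝕜 → ℝ) : Prop where
  hmul : ∀ f g : Kex 𝕜, f ≠ 0 → g ≠ 0 → ν (f * g) = ν f + ν g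
  hadd : ∀ f g : Kex 𝕜, f ≠ 0 → g ≠ 0 → f + g ≠ 0 → min (ν f) (ν g) ≤ ν (f + g)
  htriv : ∀ c : 𝕜, c ≠ 0 → ν (emb 𝕜 (MvPolynomial.C c)) = 0
  hmono : ∀ p : MvPolynomial (Fin 3) 𝕜, p ≠ 0 →
    ν (emb 𝕜 p) = sInf {t : ℝ | ∃ dd ∈ p.support, t = wdeg dd}

/-- The element `z = y²/x + y⁵/x⁵ + z′` of `K`. -/
noncomputable def zel (𝕜 : Type) [Field 𝕜] : Kex 𝕜 :=
  yv 𝕜 ^ 2 / xv 𝕜 + yv 𝕜 ^ 5 / xv 𝕜 ^ 5 + z'v 𝕜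

/-- The evaluation map `𝕜[X₀, X₁, X₂] → K` sending `X₀ ↦ x`, `X₁ ↦ y`, `X₂ ↦ z`. -/
noncomputable def evz (𝕜 : Type) [Field 𝕜] : MvPolynomial (Fin 3) 𝕜 →+* Kex 𝕜 :=
  MvPolynomial.eval₂Hom ((emb 𝕜).comp (MvPolynomial.C : 𝕜 →+* MvPolynomial (Fin 3) 𝕜))
    (fun i => if i = 0 then xv 𝕜 else if i = 1 then yv 𝕜 else zel 𝕜)

/-- The local ring `R = 𝕜[x, y, z]_{(x, y, z)}`, as a subset of `K`: quotients `p/q` of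
polynomial expressions in `x, y, z` over `𝕜` where `q` has nonzero constant term. -/
noncomputable def Rloc (𝕜 : Type) [Field 𝕜] : Set (Kex 𝕜) :=
  {f | ∃ p q : MvPolynomial (Fin 3) 𝕜, MvPolynomial.coeff 0 q ≠ 0 ∧ f = evz 𝕜 p / evz 𝕜 q}

end JumpExample

namespace JumpExample

/-- The seven generators `1, √2, 2√2 − 1, 5√2 − 4, √51 − 2, √51 + √2 − 3, 2√51 − 5`
of the value semigroup. -/
noncomputable def gval : Fin 7 → ℝ :=
  fun e =>
    match e with
    | 0 => 1
    | 1 => Real.sqrt 2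
    | 2 => 2 * Real.sqrt 2 - 1
    | 3 => 5 * Real.sqrt 2 - 4
    | 4 => Real.sqrt 51 - 2
    | 5 => Real.sqrt 51 + Real.sqrt 2 - 3
    | 6 => 2 * Real.sqrt 51 - 5

/-! ### Square roots -/

lemma sqrt_two_bounds : (1.41421 : ℝ) < √2 ∧ √2 < 1.41422 :=
  ⟨Real.lt_sqrt_of_sq_lt (by norm_num), (Real.sqrt_lt' (by norm_num)).2 (by norm_num)⟩

lemma sqrt_fiftyOne_bounds : (7.14142 : ℝ) < √51 ∧ √51 < 7.14143 :=
  ⟨Real.lt_sqrt_of_sq_lt (by norm_num), (Real.sqrt_lt' (by norm_num)).2 (by norm_num)⟩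

lemma not_isSquare_of_lt_of_lt {n k : ℕ} (h₁ : k * k < n) (h₂ : n < (k + 1) * (k + 1)) :
    ¬ IsSquare n := by
  rintro ⟨m, rfl⟩
  have := Nat.mul_self_lt_mul_self_iff.1 h₁
  have := Nat.mul_self_lt_mul_self_iff.1 h₂
  omega

/-- A natural number strictly between consecutive squares has a square root that is
linearly independent from `1` over the integers. -/
lemma int_add_mul_sqrt_eq_zero {n k : ℕ} (h₁ : k * k < n) (h₂ : n < (k + 1) * (k + 1))
    {p q : ℤ} (h : (p : ℝ) + q * √n = 0) : q = 0 := by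
  by_contra hq
  have hirr := irrational_sqrt_natCast_iff.2 (not_isSquare_of_lt_of_lt h₁ h₂)
  exact ((hirr.intCast_mul hq).intCast_add p).ne_zero h

/-- The real numbers `1`, `√2` and `√51` are linearly independent over the integers. -/
lemma int_combination_sqrt_eq_zero {p q r : ℤ} (h : (p : ℝ) + q * √2 + r * √51 = 0) :
    p = 0 ∧ q = 0 ∧ r = 0 := by
  have h2 : √2 * √2 = 2 := Real.mul_self_sqrt (by norm_num)
  have h51 : √51 * √51 = 51 := Real.mul_self_sqrt (by norm_num)
  have h102 : √2 * √51 = √102 := by rw [← Real.sqrt_mul (by norm_num)]; norm_num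
  have hqr : 2 * q * r = 0 := by
    refine int_add_mul_sqrt_eq_zero (n := 102) (k := 10) (by norm_num) (by norm_num)
      (p := 2 * q ^ 2 + 51 * r ^ 2 - p ^ 2) ?_
    push_cast
    linear_combination (q * √2 + r * √51 - p) * h - (q : ℝ) ^ 2 * h2 - (r : ℝ) ^ 2 * h51
      - 2 * q * r * h102
  have hzero : q = 0 ∧ r = 0 := by
    rcases mul_eq_zero.1 hqr with hq | hr
    · have hq : q = 0 := by omega
      subst hq
      exact ⟨rfl, int_add_mul_sqrt_eq_zero (n := 51) (k := 7) (by norm_num) (by norm_num)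
        (p := p) (by push_cast at h ⊢; linarith)⟩
    · subst hr
      exact ⟨int_add_mul_sqrt_eq_zero (n := 2) (k := 1) (by norm_num) (by norm_num)
        (p := p) (by push_cast at h ⊢; linarith), rfl⟩
  obtain ⟨rfl, rfl⟩ := hzero
  simpa using h

/-! ### Weights of exponent vectors -/

/-- The weight of an exponent vector with respect to the seven generators. -/
noncomputable def weight (e : Fin 7 → ℕ) : ℝ := ∑ ℓ, (e ℓ : ℝ) * gval ℓ

lemma weight_eq (e : Fin 7 → ℕ) :
    weight e = e 0 + e 1 * √2 + e 2 * (2 * √2 - 1) + e 3 * (5 * √2 - 4) + e 4 * (√51 - 2)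
      + e 5 * (√51 + √2 - 3) + e 6 * (2 * √51 - 5) := by
  simp [weight, Fin.sum_univ_succ, gval, Fin.succ]
  ring

lemma weight_add (e e' : Fin 7 → ℕ) : weight (e + e') = weight e + weight e' := by
  simp [weight, add_mul, Finset.sum_add_distrib]

lemma weight_single (i : Fin 7) : weight (fun j => if j = i then 1 else 0) = gval i := by
  simp [weight]

lemma one_le_gval (i : Fin 7) : 1 ≤ gval i := by
  have := sqrt_two_bounds
  have := sqrt_fiftyOne_bounds
  fin_cases i <;> simp only [gval] <;> linarith

lemma le_weight (e : Fin 7 → ℕ) (i : Fin 7) : (e i : ℝ) ≤ weight e := by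
  have h (j : Fin 7) : 0 ≤ (e j : ℝ) * gval j :=
    mul_nonneg (Nat.cast_nonneg _) (by linarith [one_le_gval j])
  calc (e i : ℝ) ≤ e i * gval i := le_mul_of_one_le_right (Nat.cast_nonneg _) (one_le_gval i)
    _ ≤ weight e := Finset.single_le_sum (fun j _ => h j) (Finset.mem_univ i)

lemma weight_nonneg (e : Fin 7 → ℕ) : 0 ≤ weight e :=
  (Nat.cast_nonneg _).trans (le_weight e 0)

lemma finite_weight_le (N : ℝ) : {e : Fin 7 → ℕ | weight e ≤ N}.Finite := by
  refine (Set.finite_Iic (fun _ : Fin 7 => ⌊N⌋₊)).subset fun e he i => ?_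
  exact Nat.le_floor ((le_weight e i).trans he)

/-- Exponent vectors of equal weight agree in the coordinates with respect to
`1`, `√2`, `√51`. -/
lemma coordinates_eq_of_weight_eq {e e' : Fin 7 → ℕ} (h : weight e = weight e') :
    (e 0 - e 2 - 4 * e 3 - 2 * e 4 - 3 * e 5 - 5 * e 6 : ℤ) =
        e' 0 - e' 2 - 4 * e' 3 - 2 * e' 4 - 3 * e' 5 - 5 * e' 6 ∧
      e 1 + 2 * e 2 + 5 * e 3 + e 5 = e' 1 + 2 * e' 2 + 5 * e' 3 + e' 5 ∧
      e 4 + e 5 + 2 * e 6 = e' 4 + e' 5 + 2 * e' 6 := by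
  rw [weight_eq, weight_eq] at h
  have key := int_combination_sqrt_eq_zero
    (p := (e 0 - e 2 - 4 * e 3 - 2 * e 4 - 3 * e 5 - 5 * e 6 : ℤ) -
        (e' 0 - e' 2 - 4 * e' 3 - 2 * e' 4 - 3 * e' 5 - 5 * e' 6))
    (q := (e 1 + 2 * e 2 + 5 * e 3 + e 5 : ℤ) - (e' 1 + 2 * e' 2 + 5 * e' 3 + e' 5))
    (r := (e 4 + e 5 + 2 * e 6 : ℤ) - (e' 4 + e' 5 + 2 * e' 6))
    (by push_cast; linear_combination h)
  omega

/-- No generator is a combination of the other six. -/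
lemma gval_not_combination (i : Fin 7) :
    ¬ ∃ b : Fin 7 → ℕ, b i = 0 ∧ gval i = ∑ ℓ, (b ℓ : ℝ) * gval ℓ := by
  rintro ⟨b, hb, h⟩
  rw [← weight_single] at h
  have key := coordinates_eq_of_weight_eq h
  rcases Nat.eq_zero_or_pos (b 2) with h2 | h2 <;> rcases Nat.eq_zero_or_pos (b 3) with h3 | h3 <;>
    fin_cases i <;> simp at key hb <;> omega

/-! ### Monomials in the seven generators -/

section Monomials

variable (𝕜 : Type) [Field 𝕜]

/-- Elements of `𝕜[x, y, z]` whose values are the seven generators. -/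
noncomputable def gen : Fin 7 → MvPolynomial (Fin 3) 𝕜 :=
  let x : MvPolynomial (Fin 3) 𝕜 := MvPolynomial.X 0
  let y : MvPolynomial (Fin 3) 𝕜 := MvPolynomial.X 1
  let z : MvPolynomial (Fin 3) 𝕜 := MvPolynomial.X 2
  let a := x * z - y ^ 2
  let b := x ^ 2 * a - y * z ^ 2
  let c := x * y * a - z ^ 3
  ![x, y, z, a, b, c, x * a * b - z ^ 2 * c]

/-- The monomial in the seven elements `gen` with the given exponents. -/
noncomputable def mon (e : Fin 7 → ℕ) : MvPolynomial (Fin 3) 𝕜 := ∏ i, gen 𝕜 i ^ e i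

/-- The span of the monomials of weight greater than `v`. -/
noncomputable def weightGt (v : ℝ) : Submodule 𝕜 (MvPolynomial (Fin 3) 𝕜) :=
  Submodule.span 𝕜 {f | ∃ e, v < weight e ∧ f = mon 𝕜 e}

variable {𝕜}

lemma mon_add (e e' : Fin 7 → ℕ) : mon 𝕜 (e + e') = mon 𝕜 e * mon 𝕜 e' := by
  simp [mon, pow_add, Finset.prod_mul_distrib]

lemma mon_mem_weightGt {v : ℝ} {e : Fin 7 → ℕ} (h : v < weight e) : mon 𝕜 e ∈ weightGt 𝕜 v :=
  Submodule.subset_span ⟨e, h, rfl⟩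

lemma weightGt_anti {v v' : ℝ} (h : v ≤ v') : weightGt 𝕜 v' ≤ weightGt 𝕜 v := by
  refine Submodule.span_mono ?_
  rintro f ⟨e, he, rfl⟩
  exact ⟨e, h.trans_lt he, rfl⟩

lemma mon_mul_mem_weightGt {v : ℝ} (e : Fin 7 → ℕ) {f : MvPolynomial (Fin 3) 𝕜}
    (hf : f ∈ weightGt 𝕜 v) : mon 𝕜 e * f ∈ weightGt 𝕜 (weight e + v) := by
  induction hf using Submodule.span_induction with
  | mem f hf =>
    obtain ⟨e', he', rfl⟩ := hf
    rw [← mon_add]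
    exact mon_mem_weightGt (by rw [weight_add]; linarith)
  | zero => simp
  | add f g _ _ hf hg => rw [mul_add]; exact add_mem hf hg
  | smul c f _ hf => rw [mul_smul_comm]; exact Submodule.smul_mem _ _ hf

/-- A linear function of the exponents that decreases under the rewriting rules. -/
def rank (e : Fin 7 → ℕ) : ℕ := e 0 + e 1 + 3 * e 4 + e 5

variable (𝕜) in
/-- The monomial `u` may be rewritten as `u'`, modulo monomials of greater weight. -/
structure Rewrites (u u' : Fin 7 → ℕ) : Prop where
  weight_eq : weight u = weight u'
  sub_mem : mon 𝕜 u - mon 𝕜 u' ∈ weightGt 𝕜 (weight u)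
  rank_lt : rank u' < rank u

lemma Rewrites.of_eq_add {u u' r : Fin 7 → ℕ} (hw : weight u = weight u')
    (hr : rank u' < rank u) (h : mon 𝕜 u = mon 𝕜 u' + mon 𝕜 r) (hlt : weight u < weight r) :
    Rewrites 𝕜 u u' :=
  ⟨hw, by rw [h, add_sub_cancel_left]; exact mon_mem_weightGt hlt, hr⟩

lemma Rewrites.of_add_eq {u u' r : Fin 7 → ℕ} (hw : weight u = weight u')
    (hr : rank u' < rank u) (h : mon 𝕜 u + mon 𝕜 r = mon 𝕜 u') (hlt : weight u < weight r) :
    Rewrites 𝕜 u u' :=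
  ⟨hw, by rw [← h, sub_add_cancel_left]; exact neg_mem (mon_mem_weightGt hlt), hr⟩

lemma Rewrites.add_left {u u' : Fin 7 → ℕ} (h : Rewrites 𝕜 u u') (e : Fin 7 → ℕ) :
    Rewrites 𝕜 (e + u) (e + u') where
  weight_eq := by rw [weight_add, weight_add, h.weight_eq]
  sub_mem := by
    rw [mon_add, mon_add, ← mul_sub, weight_add]
    exact mon_mul_mem_weightGt e h.sub_mem
  rank_lt := by
    have := h.rank_lt
    simp only [rank, Pi.add_apply] at this ⊢
    omega

/-! The rewriting rules, with the exponents of the seven generators in order. -/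

lemma rewrites_ysq : Rewrites 𝕜 ![0, 2, 0, 0, 0, 0, 0] ![1, 0, 1, 0, 0, 0, 0] := by
  have := sqrt_two_bounds
  have := sqrt_fiftyOne_bounds
  refine .of_add_eq (r := ![0, 0, 0, 1, 0, 0, 0]) ?_ ?_ ?_ ?_
  · simp [weight_eq]; try ring
  · simp [rank]
  · simp [mon, gen, Fin.prod_univ_succ]; try ring
  · simp [weight_eq]; linarith

lemma rewrites_xxa : Rewrites 𝕜 ![2, 0, 0, 1, 0, 0, 0] ![0, 1, 2, 0, 0, 0, 0] := by
  have := sqrt_two_bounds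
  have := sqrt_fiftyOne_bounds
  refine .of_eq_add (r := ![0, 0, 0, 0, 1, 0, 0]) ?_ ?_ ?_ ?_
  · simp [weight_eq]; try ring
  · simp [rank]
  · simp [mon, gen, Fin.prod_univ_succ]; try ring
  · simp [weight_eq]; linarith

lemma rewrites_xya : Rewrites 𝕜 ![1, 1, 0, 1, 0, 0, 0] ![0, 0, 3, 0, 0, 0, 0] := by
  have := sqrt_two_bounds
  have := sqrt_fiftyOne_bounds
  refine .of_eq_add (r := ![0, 0, 0, 0, 0, 1, 0]) ?_ ?_ ?_ ?_
  · simp [weight_eq]; try ring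
  · simp [rank]
  · simp [mon, gen, Fin.prod_univ_succ]; try ring
  · simp [weight_eq]; linarith

lemma rewrites_bsq : Rewrites 𝕜 ![0, 0, 0, 0, 2, 0, 0] ![1, 0, 0, 0, 0, 0, 1] := by
  have := sqrt_two_bounds
  have := sqrt_fiftyOne_bounds
  refine .of_add_eq (r := ![0, 0, 4, 1, 0, 0, 0]) ?_ ?_ ?_ ?_
  · simp [weight_eq]; try ring
  · simp [rank]
  · simp [mon, gen, Fin.prod_univ_succ]; try ring
  · simp [weight_eq]; linarith

lemma rewrites_bc : Rewrites 𝕜 ![0, 0, 0, 0, 1, 1, 0] ![0, 1, 0, 0, 0, 0, 1] := by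
  have := sqrt_two_bounds
  have := sqrt_fiftyOne_bounds
  refine .of_add_eq (r := ![1, 0, 2, 2, 0, 0, 0]) ?_ ?_ ?_ ?_
  · simp [weight_eq]; try ring
  · simp [rank]
  · simp [mon, gen, Fin.prod_univ_succ]; try ring
  · simp [weight_eq]; linarith

lemma rewrites_csq : Rewrites 𝕜 ![0, 0, 0, 0, 0, 2, 0] ![0, 0, 1, 0, 0, 0, 1] := by
  have := sqrt_two_bounds
  have := sqrt_fiftyOne_bounds
  refine .of_add_eq (r := ![2, 0, 0, 3, 0, 0, 0]) ?_ ?_ ?_ ?_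
  · simp [weight_eq]; try ring
  · simp [rank]
  · simp [mon, gen, Fin.prod_univ_succ]; try ring
  · simp [weight_eq]; linarith

lemma rewrites_yb : Rewrites 𝕜 ![0, 1, 0, 0, 1, 0, 0] ![1, 0, 0, 0, 0, 1, 0] := by
  have := sqrt_two_bounds
  have := sqrt_fiftyOne_bounds
  refine .of_eq_add (r := ![0, 0, 2, 1, 0, 0, 0]) ?_ ?_ ?_ ?_
  · simp [weight_eq]; try ring
  · simp [rank]
  · simp [mon, gen, Fin.prod_univ_succ]; try ring
  · simp [weight_eq]; linarith

lemma rewrites_zb : Rewrites 𝕜 ![0, 0, 1, 0, 1, 0, 0] ![0, 1, 0, 0, 0, 1, 0] := by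
  have := sqrt_two_bounds
  have := sqrt_fiftyOne_bounds
  refine .of_eq_add (r := ![1, 0, 0, 2, 0, 0, 0]) ?_ ?_ ?_ ?_
  · simp [weight_eq]; try ring
  · simp [rank]
  · simp [mon, gen, Fin.prod_univ_succ]; try ring
  · simp [weight_eq]; linarith

lemma rewrites_xab : Rewrites 𝕜 ![1, 0, 0, 1, 1, 0, 0] ![0, 0, 2, 0, 0, 1, 0] := by
  have := sqrt_two_bounds
  have := sqrt_fiftyOne_bounds
  refine .of_eq_add (r := ![0, 0, 0, 0, 0, 0, 1]) ?_ ?_ ?_ ?_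
  · simp [weight_eq]; try ring
  · simp [rank]
  · simp [mon, gen, Fin.prod_univ_succ]; try ring
  · simp [weight_eq]; linarith

/-- Exponent vectors to which no rewriting rule applies. -/
def IsNormal (e : Fin 7 → ℕ) : Prop :=
  e 1 ≤ 1 ∧ (e 0 ≤ 1 ∨ e 3 = 0) ∧ (e 0 = 0 ∨ e 1 = 0 ∨ e 3 = 0) ∧ e 4 ≤ 1 ∧
    (e 4 = 0 ∨ e 5 = 0) ∧ e 5 ≤ 1 ∧ (e 1 = 0 ∨ e 4 = 0) ∧ (e 2 = 0 ∨ e 4 = 0) ∧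
    (e 0 = 0 ∨ e 3 = 0 ∨ e 4 = 0)

variable (𝕜) in
lemma exists_rewrites_of_not_isNormal {e : Fin 7 → ℕ} (he : ¬ IsNormal e) :
    ∃ u u', u ≤ e ∧ Rewrites 𝕜 u u' := by
  by_contra! h
  have h₁ := fun hu => h _ _ hu rewrites_ysq
  have h₂ := fun hu => h _ _ hu rewrites_xxa
  have h₃ := fun hu => h _ _ hu rewrites_xya
  have h₄ := fun hu => h _ _ hu rewrites_bsq
  have h₅ := fun hu => h _ _ hu rewrites_bc
  have h₆ := fun hu => h _ _ hu rewrites_csq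
  have h₇ := fun hu => h _ _ hu rewrites_yb
  have h₈ := fun hu => h _ _ hu rewrites_zb
  have h₉ := fun hu => h _ _ hu rewrites_xab
  simp [Pi.le_def, Fin.forall_fin_succ, Fin.succ] at h₁ h₂ h₃ h₄ h₅ h₆ h₇ h₈ h₉
  refine he ?_
  unfold IsNormal
  omega

variable (𝕜) in
/-- Every monomial agrees with a normal one of the same weight, modulo monomials of
greater weight. -/
lemma exists_isNormal (e : Fin 7 → ℕ) : ∃ n, IsNormal n ∧ weight n = weight e ∧
    mon 𝕜 e - mon 𝕜 n ∈ weightGt 𝕜 (weight e) := by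
  induction hk : rank e using Nat.strong_induction_on generalizing e with
  | _ k ih =>
    by_cases he : IsNormal e
    · exact ⟨e, he, rfl, by simp⟩
    · obtain ⟨u, u', hu, h⟩ := exists_rewrites_of_not_isNormal 𝕜 he
      have h' := h.add_left (e - u)
      rw [tsub_add_cancel_of_le hu] at h'
      obtain ⟨n, hn, hw, hm⟩ := ih _ (hk ▸ h'.rank_lt) _ rfl
      refine ⟨n, hn, hw.trans h'.weight_eq.symm, ?_⟩
      rw [← h'.weight_eq] at hm
      simpa using add_mem h'.sub_mem hm

lemma eq_of_normal_of_eq {x y z a x' y' z' a' : ℕ} (hy : y ≤ 1) (hx : x ≤ 1 ∨ a = 0)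
    (hxy : x = 0 ∨ y = 0 ∨ a = 0) (hy' : y' ≤ 1) (hx' : x' ≤ 1 ∨ a' = 0)
    (hxy' : x' = 0 ∨ y' = 0 ∨ a' = 0) (h₁ : x + z' + 4 * a' = x' + z + 4 * a)
    (h₂ : y + 2 * z + 5 * a = y' + 2 * z' + 5 * a') :
    x = x' ∧ y = y' ∧ z = z' ∧ a = a' := by
  rcases lt_trichotomy a a' with h | rfl | h
  · have : x' + y' ≤ 1 := by omega
    clear hx hxy hx' hxy'
    omega
  · clear hx hxy hx' hxy'
    omega
  · have : x + y ≤ 1 := by omega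
    clear hx hxy hx' hxy'
    omega

/-- The exponent of the fifth generator is the same in normal vectors of equal weight. -/
lemma IsNormal.false_of_weight_eq {e e' : Fin 7 → ℕ} (he : IsNormal e) (he' : IsNormal e')
    (h : weight e = weight e') (h4 : e 4 = 1) (h4' : e' 4 = 0) : False := by
  obtain ⟨k₁, k₂, k₃⟩ := coordinates_eq_of_weight_eq h
  obtain ⟨-, -, -, -, hbc, -, hyb, hzb, hxab⟩ := he
  obtain ⟨-, -, -, -, -, hc', -, -, -⟩ := he'
  have h5 : e 5 = 0 := by clear k₁ k₂ k₃ hyb hzb hxab; omega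
  have h1 : e 1 = 0 := by clear k₁ k₂ k₃ hzb hxab hbc; omega
  have h2 : e 2 = 0 := by clear k₁ k₂ k₃ hyb hxab hbc; omega
  clear hyb hzb hbc
  have h5' : e' 5 = 1 := by clear k₁ k₂ hxab; omega
  rcases hxab with h | h | h <;> omega

lemma IsNormal.eq_of_weight_eq {e e' : Fin 7 → ℕ} (he : IsNormal e) (he' : IsNormal e')
    (h : weight e = weight e') : e = e' := by
  have h4 : e 4 = e' 4 := by
    have h₁ := he.false_of_weight_eq he' h
    have h₂ := he'.false_of_weight_eq he h.symm
    have hb := he.2.2.2.1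
    have hb' := he'.2.2.2.1
    by_contra hne
    rcases (by omega : (e 4 = 1 ∧ e' 4 = 0) ∨ (e' 4 = 1 ∧ e 4 = 0)) with ⟨h, h'⟩ | ⟨h, h'⟩
    exacts [h₁ h h', h₂ h h']
  obtain ⟨k₁, k₂, k₃⟩ := coordinates_eq_of_weight_eq h
  obtain ⟨hy, hx, hxy, -, -, hc, -⟩ := he
  obtain ⟨hy', hx', hxy', -, -, hc', -⟩ := he'
  have h56 : e 5 = e' 5 ∧ e 6 = e' 6 := by clear k₁ k₂ hx hxy hx' hxy'; omega
  have := eq_of_normal_of_eq hy hx hxy hy' hx' hxy' (z := e 2) (z' := e' 2)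
    (by clear hx hxy hx' hxy'; omega) (by clear hx hxy hx' hxy'; omega)
  ext i
  fin_cases i <;> simp [this, h4, h56]

variable (𝕜) in
/-- Monomials of equal weight agree modulo monomials of greater weight. -/
lemma mon_sub_mon_mem_weightGt {e e' : Fin 7 → ℕ} (h : weight e = weight e') :
    mon 𝕜 e - mon 𝕜 e' ∈ weightGt 𝕜 (weight e) := by
  obtain ⟨n, hn, hw, hm⟩ := exists_isNormal 𝕜 e
  obtain ⟨n', hn', hw', hm'⟩ := exists_isNormal 𝕜 e'
  obtain rfl := hn.eq_of_weight_eq hn' (hw.trans (h.trans hw'.symm))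
  rw [← h] at hm'
  simpa using sub_mem hm hm'

lemma monomial_eq_smul_mon (s : Fin 3 →₀ ℕ) (c : 𝕜) :
    MvPolynomial.monomial s c = c • mon 𝕜 ![s 0, s 1, s 2, 0, 0, 0, 0] := by
  rw [MvPolynomial.monomial_eq, MvPolynomial.smul_eq_C_mul, Finsupp.prod_fintype _ _ (by simp)]
  simp [mon, gen, Fin.prod_univ_succ]

/-- A polynomial differs from its constant term by a combination of monomials of positive
weight. -/
lemma sub_C_coeff_mem_weightGt (p : MvPolynomial (Fin 3) 𝕜) :
    p - MvPolynomial.C (MvPolynomial.coeff 0 p) ∈ weightGt 𝕜 0 := by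
  induction p using MvPolynomial.induction_on' with
  | monomial s c =>
    by_cases hs : s = 0
    · subst hs; simp
    · rw [MvPolynomial.coeff_monomial, if_neg hs, map_zero, sub_zero, monomial_eq_smul_mon]
      refine Submodule.smul_mem _ _ (mon_mem_weightGt ?_)
      obtain ⟨i, hi⟩ := Finsupp.ne_iff.1 hs
      have hi' : (0 : ℝ) < s i := by exact_mod_cast Nat.pos_of_ne_zero hi
      let e : Fin 7 → ℕ := ![s 0, s 1, s 2, 0, 0, 0, 0]
      have h0 := le_weight e 0
      have h1 := le_weight e 1
      have h2 := le_weight e 2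
      fin_cases i
      · exact hi'.trans_le h0
      · exact hi'.trans_le h1
      · exact hi'.trans_le h2
  | add p q hp hq =>
    rw [MvPolynomial.coeff_add, map_add, add_sub_add_comm]
    exact add_mem hp hq

lemma mem_weightGt_of_neg {v : ℝ} (hv : v < 0) (p : MvPolynomial (Fin 3) 𝕜) :
    p ∈ weightGt 𝕜 v := by
  have h1 : MvPolynomial.C (MvPolynomial.coeff 0 p) ∈ weightGt 𝕜 v := by
    rw [MvPolynomial.C_apply, monomial_eq_smul_mon]
    exact Submodule.smul_mem _ _ (mon_mem_weightGt (hv.trans_le (weight_nonneg _)))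
  simpa using add_mem (weightGt_anti hv.le (sub_C_coeff_mem_weightGt p)) h1

end Monomials

/-! ### Values of the generators -/

section Values

variable {𝕜 : Type} [Field 𝕜] {ν : Kex 𝕜 → ℝ}

/-- `f` is nonzero of value `v`. -/
def HasVal (ν : Kex 𝕜 → ℝ) (f : Kex 𝕜) (v : ℝ) : Prop := f ≠ 0 ∧ ν f = v

/-- `f` has value at least `v`, where zero has infinite value. -/
def ValGe (ν : Kex 𝕜 → ℝ) (f : Kex 𝕜) (v : ℝ) : Prop := f = 0 ∨ v ≤ ν f

lemma HasVal.valGe {f : Kex 𝕜} {v : ℝ} (h : HasVal ν f v) : ValGe ν f v := Or.inr h.2.ge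

lemma ValGe.mono {f : Kex 𝕜} {v w : ℝ} (h : ValGe ν f v) (hw : w ≤ v) : ValGe ν f w :=
  h.imp_right hw.trans

namespace IsMonomialValuation

variable (hν : IsMonomialValuation 𝕜 ν)

include hν

lemma hasVal_C {c : 𝕜} (hc : c ≠ 0) : HasVal ν (emb 𝕜 (MvPolynomial.C c)) 0 := by
  refine ⟨?_, hν.htriv c hc⟩
  simpa [emb] using hc

lemma hasVal_X (i : Fin 3) :
    HasVal ν (emb 𝕜 (MvPolynomial.X i)) (wdeg (Finsupp.single i 1)) := by
  have hX : (MvPolynomial.X i : MvPolynomial (Fin 3) 𝕜) ≠ 0 := MvPolynomial.X_ne_zero i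
  refine ⟨?_, ?_⟩
  · simp [emb]
  · rw [hν.hmono _ hX, MvPolynomial.support_X]
    simp

lemma hasVal_xv : HasVal ν (xv 𝕜) 1 := by
  simpa [wdeg, xv] using hν.hasVal_X 0

lemma hasVal_yv : HasVal ν (yv 𝕜) √2 := by
  simpa [wdeg, yv] using hν.hasVal_X 1

lemma hasVal_z'v : HasVal ν (z'v 𝕜) (√51 - 5) := by
  simpa [wdeg, z'v] using hν.hasVal_X 2

lemma hasVal_one : HasVal ν 1 0 := by
  simpa using hν.hasVal_C one_ne_zero

lemma hasVal_mul {f g : Kex 𝕜} {v w : ℝ} (hf : HasVal ν f v) (hg : HasVal ν g w) :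
    HasVal ν (f * g) (v + w) :=
  ⟨mul_ne_zero hf.1 hg.1, by rw [hν.hmul f g hf.1 hg.1, hf.2, hg.2]⟩

lemma hasVal_pow {f : Kex 𝕜} {v : ℝ} (hf : HasVal ν f v) (n : ℕ) : HasVal ν (f ^ n) (n * v) := by
  induction n with
  | zero => simpa using hν.hasVal_one
  | succ n ih =>
    have := hν.hasVal_mul ih hf
    rw [pow_succ]
    convert this using 1
    push_cast
    ring

lemma hasVal_div {f g : Kex 𝕜} {v w : ℝ} (hf : HasVal ν f v) (hg : HasVal ν g w) :
    HasVal ν (f / g) (v - w) := by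
  have hne := div_ne_zero hf.1 hg.1
  refine ⟨hne, ?_⟩
  have h := hν.hmul _ _ hne hg.1
  rw [div_mul_cancel₀ _ hg.1, hf.2, hg.2] at h
  linarith

lemma valGe_mul {f g : Kex 𝕜} {v w : ℝ} (hf : ValGe ν f v) (hg : ValGe ν g w) :
    ValGe ν (f * g) (v + w) := by
  by_cases hf0 : f = 0
  · exact Or.inl (by simp [hf0])
  by_cases hg0 : g = 0
  · exact Or.inl (by simp [hg0])
  right
  rw [hν.hmul f g hf0 hg0]
  exact add_le_add (hf.resolve_left hf0) (hg.resolve_left hg0)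

lemma valGe_add {f g : Kex 𝕜} {v : ℝ} (hf : ValGe ν f v) (hg : ValGe ν g v) :
    ValGe ν (f + g) v := by
  by_cases hf0 : f = 0
  · rwa [hf0, zero_add]
  by_cases hg0 : g = 0
  · rwa [hg0, add_zero]
  by_cases h : f + g = 0
  · exact Or.inl h
  exact Or.inr ((le_min (hf.resolve_left hf0) (hg.resolve_left hg0)).trans (hν.hadd f g hf0 hg0 h))

lemma valGe_neg {f : Kex 𝕜} {v : ℝ} (hf : ValGe ν f v) : ValGe ν (-f) v := by
  have h := hν.hasVal_C (c := -1) (by simp)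
  simpa using hν.valGe_mul h.valGe hf

lemma valGe_pow {f : Kex 𝕜} {v : ℝ} (hf : ValGe ν f v) (n : ℕ) : ValGe ν (f ^ n) (n * v) := by
  by_cases hn : n = 0
  · subst hn
    simpa using hν.hasVal_one.valGe
  · by_cases hf0 : f = 0
    · exact Or.inl (by simp [hf0, hn])
    · have h := (hν.hasVal_pow ⟨hf0, rfl⟩ n).valGe
      exact h.mono (mul_le_mul_of_nonneg_left (hf.resolve_left hf0) (Nat.cast_nonneg n))

lemma valGe_natCast_mul {f : Kex 𝕜} {v : ℝ} (hf : ValGe ν f v) (n : ℕ) : ValGe ν (n * f) v := by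
  induction n with
  | zero => exact Or.inl (by simp)
  | succ n ih =>
    rw [Nat.cast_succ, add_mul, one_mul]
    exact hν.valGe_add ih hf

lemma hasVal_add {f g : Kex 𝕜} {v w : ℝ} (hf : HasVal ν f v) (hg : ValGe ν g w) (h : v < w) :
    HasVal ν (f + g) v := by
  rcases hg with rfl | hg
  · rwa [add_zero]
  have hne : f + g ≠ 0 := by
    intro h0
    have h1 := hν.valGe_neg (f := g) (Or.inr hg)
    rw [← eq_neg_of_add_eq_zero_left h0] at h1
    have h2 := h1.resolve_left hf.1
    rw [hf.2] at h2
    linarith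
  refine ⟨hne, le_antisymm ?_ ?_⟩
  · by_contra! hlt
    have h1 := hν.valGe_add (v := min (ν (f + g)) w) (f := f + g) (Or.inr (min_le_left _ _))
      ((hν.valGe_neg (Or.inr hg)).mono (min_le_right _ _))
    rw [add_neg_cancel_right] at h1
    have h2 := h1.resolve_left hf.1
    rw [hf.2] at h2
    exact absurd h2 (not_le.2 (lt_min hlt h))
  · exact (hν.valGe_add hf.valGe (ValGe.mono (Or.inr hg) h.le)).resolve_left hne

end IsMonomialValuation

lemma evz_C (c : 𝕜) : evz 𝕜 (MvPolynomial.C c) = emb 𝕜 (MvPolynomial.C c) := by simp [evz]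

lemma evz_smul (c : 𝕜) (p : MvPolynomial (Fin 3) 𝕜) :
    evz 𝕜 (c • p) = emb 𝕜 (MvPolynomial.C c) * evz 𝕜 p := by
  rw [MvPolynomial.smul_eq_C_mul, map_mul, evz_C]

lemma evz_X_zero : evz 𝕜 (MvPolynomial.X 0) = xv 𝕜 := by simp [evz]

lemma evz_X_one : evz 𝕜 (MvPolynomial.X 1) = yv 𝕜 := by simp [evz]

lemma evz_X_two : evz 𝕜 (MvPolynomial.X 2) = zel 𝕜 := by simp [evz]

namespace IsMonomialValuation

variable (hν : IsMonomialValuation 𝕜 ν)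

include hν

/-- The value of each generator in `K`. -/
lemma hasVal_gen (i : Fin 7) : HasVal ν (evz 𝕜 (gen 𝕜 i)) (gval i) := by
  obtain ⟨hs, hs'⟩ := sqrt_two_bounds
  obtain ⟨ht, ht'⟩ := sqrt_fiftyOne_bounds
  have hx := hν.hasVal_xv
  have hy := hν.hasVal_yv
  have hz' := hν.hasVal_z'v
  have hx0 := hx.1
  have hS := hν.hasVal_div (hν.hasVal_pow hy 2) hx
  have hT := hν.hasVal_div (hν.hasVal_pow hy 5) (hν.hasVal_pow hx 5)
  have hz : zel 𝕜 = yv 𝕜 ^ 2 / xv 𝕜 + (yv 𝕜 ^ 5 / xv 𝕜 ^ 5 + z'v 𝕜) := by rw [zel, add_assoc]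
  have e1 : xv 𝕜 * (yv 𝕜 ^ 2 / xv 𝕜) = yv 𝕜 ^ 2 := by field_simp
  have e2 : xv 𝕜 ^ 3 * (yv 𝕜 ^ 5 / xv 𝕜 ^ 5) = yv 𝕜 * (yv 𝕜 ^ 2 / xv 𝕜) ^ 2 := by field_simp
  have e3 : xv 𝕜 ^ 2 * yv 𝕜 * (yv 𝕜 ^ 5 / xv 𝕜 ^ 5) = (yv 𝕜 ^ 2 / xv 𝕜) ^ 3 := by field_simp
  generalize yv 𝕜 ^ 2 / xv 𝕜 = S at *
  generalize yv 𝕜 ^ 5 / xv 𝕜 ^ 5 = T at *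
  have g0 : evz 𝕜 (gen 𝕜 0) = xv 𝕜 := evz_X_zero
  have g1 : evz 𝕜 (gen 𝕜 1) = yv 𝕜 := evz_X_one
  have g2 : evz 𝕜 (gen 𝕜 2) = zel 𝕜 := evz_X_two
  have g3 : evz 𝕜 (gen 𝕜 3) = xv 𝕜 * zel 𝕜 - yv 𝕜 ^ 2 := by
    simp [gen, evz_X_zero, evz_X_one, evz_X_two]
  have g4 : evz 𝕜 (gen 𝕜 4) = xv 𝕜 ^ 2 * evz 𝕜 (gen 𝕜 3) - yv 𝕜 * zel 𝕜 ^ 2 := by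
    simp [gen, evz_X_zero, evz_X_one, evz_X_two]
  have g5 : evz 𝕜 (gen 𝕜 5) = xv 𝕜 * yv 𝕜 * evz 𝕜 (gen 𝕜 3) - zel 𝕜 ^ 3 := by
    simp [gen, evz_X_zero, evz_X_one, evz_X_two]
  have g6 : evz 𝕜 (gen 𝕜 6) = xv 𝕜 * evz 𝕜 (gen 𝕜 3) * evz 𝕜 (gen 𝕜 4)
      - zel 𝕜 ^ 2 * evz 𝕜 (gen 𝕜 5) := by
    simp [gen, evz_X_zero, evz_X_one, evz_X_two]
  generalize zel 𝕜 = z at *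
  obtain ⟨U, hU⟩ : ∃ U, U = T + z'v 𝕜 := ⟨_, rfl⟩
  rw [← hU] at hz
  subst hz
  have hUv : HasVal ν U (5 * √2 - 5) := by
    rw [hU]
    convert hν.hasVal_add hT hz'.valGe (by push_cast; linarith) using 1
    norm_num
  replace hS : HasVal ν S (2 * √2 - 1) := by simpa using hS
  have hZ : HasVal ν (S + U) (2 * √2 - 1) := hν.hasVal_add hS hUv.valGe (by linarith)
  have hQ : ValGe ν (2 * S + U) (2 * √2 - 1) :=
    hν.valGe_add (by simpa using hν.valGe_natCast_mul hS.valGe 2) (hUv.valGe.mono (by linarith))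
  have hR : ValGe ν (3 * S ^ 2 + 3 * (S * U) + U ^ 2) (4 * √2 - 2) := by
    refine hν.valGe_add (hν.valGe_add ?_ ?_) ?_
    · have := hν.valGe_natCast_mul (hν.valGe_pow hS.valGe 2) 3
      push_cast at this
      exact this.mono (by linarith)
    · have := hν.valGe_natCast_mul (hν.valGe_mul hS.valGe hUv.valGe) 3
      push_cast at this
      exact this.mono (by linarith)
    · exact (hν.valGe_pow hUv.valGe 2).mono (by push_cast; linarith)
  replace g3 : evz 𝕜 (gen 𝕜 3) = xv 𝕜 * U := by rw [g3]; linear_combination e1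
  replace g4 : evz 𝕜 (gen 𝕜 4) = xv 𝕜 ^ 3 * z'v 𝕜 + -(yv 𝕜 * U * (2 * S + U)) := by
    rw [g4, g3]; linear_combination e2 + xv 𝕜 ^ 3 * hU
  replace g5 : evz 𝕜 (gen 𝕜 5) = xv 𝕜 ^ 2 * yv 𝕜 * z'v 𝕜
      + -(U * (3 * S ^ 2 + 3 * (S * U) + U ^ 2)) := by
    rw [g5, g3]; linear_combination e3 + xv 𝕜 ^ 2 * yv 𝕜 * hU
  replace g6 : evz 𝕜 (gen 𝕜 6) = xv 𝕜 ^ 5 * z'v 𝕜 ^ 2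
      + U * (-(xv 𝕜 ^ 2 * yv 𝕜 * U * (2 * S + U)) + -((2 * S + U) * (xv 𝕜 ^ 2 * yv 𝕜 * z'v 𝕜))
        + (S + U) ^ 2 * (3 * S ^ 2 + 3 * (S * U) + U ^ 2)) := by
    rw [g6, g3, g4, g5]
    linear_combination xv 𝕜 ^ 2 * z'v 𝕜 * e2 + xv 𝕜 ^ 5 * z'v 𝕜 * hU
  have hxy := hν.hasVal_mul (hν.hasVal_pow hx 2) hy
  fin_cases i <;> simp only [gval, Fin.zero_eta, Fin.mk_one, Fin.reduceFinMk]
  · rwa [g0]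
  · rwa [g1]
  · rwa [g2]
  · rw [g3]
    convert hν.hasVal_mul hx hUv using 1
    ring
  · rw [g4]
    convert hν.hasVal_add (hν.hasVal_mul (hν.hasVal_pow hx 3) hz')
      (hν.valGe_neg (hν.valGe_mul (hν.hasVal_mul hy hUv).valGe hQ)) (by push_cast; linarith) using 1
    push_cast
    ring
  · rw [g5]
    convert hν.hasVal_add (hν.hasVal_mul hxy hz')
      (hν.valGe_neg (hν.valGe_mul hUv.valGe hR)) (by push_cast; linarith) using 1
    push_cast
    ring
  · rw [g6]
    have hsum : ValGe ν (-(xv 𝕜 ^ 2 * yv 𝕜 * U * (2 * S + U))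
        + -((2 * S + U) * (xv 𝕜 ^ 2 * yv 𝕜 * z'v 𝕜))
        + (S + U) ^ 2 * (3 * S ^ 2 + 3 * (S * U) + U ^ 2)) (8 * √2 - 4) := by
      refine hν.valGe_add (hν.valGe_add ?_ ?_) ?_
      · exact (hν.valGe_neg (hν.valGe_mul (hν.hasVal_mul hxy hUv).valGe hQ)).mono
          (by push_cast; linarith)
      · exact (hν.valGe_neg (hν.valGe_mul hQ (hν.hasVal_mul hxy hz').valGe)).mono
          (by push_cast; linarith)
      · exact (hν.valGe_mul (hν.hasVal_pow hZ 2).valGe hR).mono (by push_cast; linarith)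
    convert hν.hasVal_add (hν.hasVal_mul (hν.hasVal_pow hx 5) (hν.hasVal_pow hz' 2))
      (hν.valGe_mul hUv.valGe hsum) (by push_cast; linarith) using 1
    push_cast
    ring

lemma hasVal_mon (e : Fin 7 → ℕ) : HasVal ν (evz 𝕜 (mon 𝕜 e)) (weight e) := by
  rw [mon, map_prod, weight]
  induction (Finset.univ : Finset (Fin 7)) using Finset.induction_on with
  | empty => simpa using hν.hasVal_one
  | insert i s hi ih =>
    rw [Finset.prod_insert hi, Finset.sum_insert hi, map_pow]
    exact hν.hasVal_mul (hν.hasVal_pow (hν.hasVal_gen i) _) ih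

/-- Combinations of monomials of weight greater than `v` have value greater than `v`. -/
lemma lt_val_of_mem_weightGt {v : ℝ} {p : MvPolynomial (Fin 3) 𝕜} (hp : p ∈ weightGt 𝕜 v)
    (h0 : evz 𝕜 p ≠ 0) : v < ν (evz 𝕜 p) := by
  suffices h : ∃ w, v < w ∧ ValGe ν (evz 𝕜 p) w by
    obtain ⟨w, hw, h⟩ := h
    exact hw.trans_le (h.resolve_left h0)
  clear h0
  induction hp using Submodule.span_induction with
  | mem f hf =>
    obtain ⟨e, he, rfl⟩ := hf
    exact ⟨_, he, (hν.hasVal_mon e).valGe⟩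
  | zero => exact ⟨v + 1, by linarith, Or.inl (map_zero _)⟩
  | add f g _ _ hf hg =>
    obtain ⟨w, hw, hf⟩ := hf
    obtain ⟨w', hw', hg⟩ := hg
    refine ⟨min w w', lt_min hw hw', ?_⟩
    rw [map_add]
    exact hν.valGe_add (hf.mono (min_le_left _ _)) (hg.mono (min_le_right _ _))
  | smul c f _ hf =>
    obtain ⟨w, hw, hf⟩ := hf
    refine ⟨w, hw, ?_⟩
    rw [evz_smul]
    by_cases hc : c = 0
    · exact Or.inl (by simp [hc])
    · simpa using hν.valGe_mul (hν.hasVal_C hc).valGe hf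

lemma hasVal_evz_add {v : ℝ} {p q : MvPolynomial (Fin 3) 𝕜} (hp : HasVal ν (evz 𝕜 p) v)
    (hq : q ∈ weightGt 𝕜 v) : HasVal ν (evz 𝕜 (p + q)) v := by
  rw [map_add]
  by_cases h0 : evz 𝕜 q = 0
  · rwa [h0, add_zero]
  · exact hν.hasVal_add hp (Or.inr le_rfl) (hν.lt_val_of_mem_weightGt hq h0)

/-- A polynomial with nonzero constant term has value zero. -/
lemma hasVal_of_coeff_zero_ne_zero {q : MvPolynomial (Fin 3) 𝕜}
    (hq : MvPolynomial.coeff 0 q ≠ 0) : HasVal ν (evz 𝕜 q) 0 := by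
  have h := hν.hasVal_evz_add (by rw [evz_C]; exact hν.hasVal_C hq) (sub_C_coeff_mem_weightGt q)
  rwa [add_sub_cancel] at h

/-- The value of a nonzero element of `𝕜[x, y, z]` is the weight of some exponent vector. -/
lemma exists_weight_eq_val {p : MvPolynomial (Fin 3) 𝕜} (h0 : evz 𝕜 p ≠ 0) :
    ∃ e, ν (evz 𝕜 p) = weight e := by
  suffices h : ∀ v, p ∈ weightGt 𝕜 v → ∃ e, ν (evz 𝕜 p) = weight e from
    h (-1) (mem_weightGt_of_neg (by norm_num) p)
  have hfin (v : ℝ) : {e | v < weight e ∧ weight e ≤ ν (evz 𝕜 p)}.Finite :=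
    (finite_weight_le _).subset fun e he => he.2
  intro v hv
  induction hk : {e | v < weight e ∧ weight e ≤ ν (evz 𝕜 p)}.ncard
    using Nat.strong_induction_on generalizing v with
  | _ k ih =>
    rcases Set.eq_empty_or_nonempty {e | v < weight e ∧ weight e ≤ ν (evz 𝕜 p)} with hE | hE
    · refine absurd (hν.lt_val_of_mem_weightGt (v := ν (evz 𝕜 p)) ?_ h0) (lt_irrefl _)
      refine Submodule.span_mono ?_ hv
      rintro f ⟨e, he, rfl⟩
      refine ⟨e, ?_, rfl⟩
      by_contra! hle
      exact hE.subset ⟨he, hle⟩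
    · obtain ⟨m, ⟨hm, hm'⟩, hmin⟩ := Set.exists_min_image _ weight (hfin v) hE
      obtain ⟨c, hc⟩ : ∃ c : 𝕜, p - c • mon 𝕜 m ∈ weightGt 𝕜 (weight m) := by
        clear ih hk h0
        have hle (e) (he : v < weight e) : weight m ≤ weight e := by
          by_contra! hlt
          exact hlt.not_ge (hmin e ⟨he, hlt.le.trans hm'⟩)
        clear hmin hE hfin hm'
        induction hv using Submodule.span_induction with
        | mem f hf =>
          obtain ⟨e, he, rfl⟩ := hf
          rcases (hle e he).lt_or_eq with hlt | heq
          · exact ⟨0, by simpa using mon_mem_weightGt hlt⟩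
          · exact ⟨1, by simpa [heq] using mon_sub_mon_mem_weightGt 𝕜 heq.symm⟩
        | zero => exact ⟨0, by simp⟩
        | add f g _ _ hf hg =>
          obtain ⟨c, hc⟩ := hf
          obtain ⟨d, hd⟩ := hg
          refine ⟨c + d, ?_⟩
          rw [add_smul, add_sub_add_comm]
          exact add_mem hc hd
        | smul b f _ hf =>
          obtain ⟨c, hc⟩ := hf
          refine ⟨b * c, ?_⟩
          rw [mul_smul, ← smul_sub]
          exact Submodule.smul_mem _ _ hc
      by_cases hc0 : c = 0
      · rw [hc0, zero_smul, sub_zero] at hc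
        refine ih _ ?_ _ hc rfl
        rw [← hk]
        refine Set.ncard_lt_ncard (Set.ssubset_iff_exists.2 ⟨?_, m, ⟨hm, hm'⟩, ?_⟩) (hfin v)
        · exact fun e he => ⟨hm.trans he.1, he.2⟩
        · exact fun h => lt_irrefl _ h.1
      · refine ⟨m, ?_⟩
        have hval : HasVal ν (evz 𝕜 (c • mon 𝕜 m)) (weight m) := by
          rw [evz_smul]
          simpa using hν.hasVal_mul (hν.hasVal_C hc0) (hν.hasVal_mon m)
        have := hν.hasVal_evz_add hval hc
        rw [add_sub_cancel] at this
        exact this.2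

end IsMonomialValuation

end Values

/-- The value semigroup `ν(R∖{0})` is exactly the set of `ℕ₀`-linear
combinations of `1, √2, 2√2 − 1, 5√2 − 4, √51 − 2, √51 + √2 − 3, 2√51 − 5`, and this
set of generators is minimal. -/
theorem value_semigroup (𝕜 : Type) [Field 𝕜] (ν : Kex 𝕜 → ℝ)
    (hν : IsMonomialValuation 𝕜 ν) :
    {t : ℝ | ∃ f, f ∈ Rloc 𝕜 ∧ f ≠ 0 ∧ ν f = t} =
      {t : ℝ | ∃ b : Fin 7 → ℕ, t = ∑ ℓ, (b ℓ : ℝ) * gval ℓ} ∧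
    ∀ ℓ0 : Fin 7, ¬ ∃ b : Fin 7 → ℕ, b ℓ0 = 0 ∧ gval ℓ0 = ∑ ℓ, (b ℓ : ℝ) * gval ℓ := by
  refine ⟨?_, gval_not_combination⟩
  ext t
  constructor
  · rintro ⟨f, ⟨p, q, hq, rfl⟩, hf, rfl⟩
    have hp : evz 𝕜 p ≠ 0 := (div_ne_zero_iff.1 hf).1
    obtain ⟨e, he⟩ := hν.exists_weight_eq_val hp
    refine ⟨e, ?_⟩
    rw [(hν.hasVal_div ⟨hp, he⟩ (hν.hasVal_of_coeff_zero_ne_zero hq)).2, sub_zero, weight]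
  · rintro ⟨b, rfl⟩
    have h := hν.hasVal_mon b
    exact ⟨evz 𝕜 (mon 𝕜 b), ⟨mon 𝕜 b, 1, by simp, by simp⟩, h.1, h.2⟩

end JumpExample
end
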